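/- arXiv:2003.06936 — 4 statements merged into one kernel-verified Lean document; each statement's English description precedes it below -/
import Mathlib

section
/- Let b, d, Δ be natural numbers with 2 ≤ b ≤ d−1 ≤ Δ−1, and set δ := Δ−b+1. Let x_1, …, x_d ∈ [0,1] be real numbers such that ∑_{j=1}^d x_j ≥ b. Then there exists a set S ⊆ {1,…,d} with |S| = b−1 such that x_j ≥ 2/(δ+1) for all j ∈ S, and there exists an index j₀ ∉ S with x_{j₀} ≥ 1/δ. -/
/-- If all values are at most `1` and those outside a proper subset `A` are below `c`, then the
total is below `|A| + (n - |A|) c`. -/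
theorem sum_lt_card_add_mul_of_lt_off {ι : Type*} [Fintype ι] [DecidableEq ι] (x : ι → ℝ)
    (hx : ∀ j, x j ≤ 1) (A : Finset ι) (hA : A.card < Fintype.card ι) (c : ℝ)
    (hc : ∀ j, j ∉ A → x j < c) :
    ∑ j, x j < A.card + ((Fintype.card ι : ℝ) - A.card) * c := by
  have hcard : ((Aᶜ).card : ℝ) = (Fintype.card ι : ℝ) - A.card := by
    rw [Finset.card_compl, Nat.cast_sub hA.le]
  have hne : (Aᶜ).Nonempty := by
    rw [← Finset.card_pos, Finset.card_compl]
    omega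
  have hin : ∑ j ∈ A, x j ≤ A.card := by
    simpa using Finset.sum_le_card_nsmul A x 1 fun j _ => hx j
  have hout : ∑ j ∈ Aᶜ, x j < (Aᶜ).card * c := by
    simpa using Finset.sum_lt_sum_of_nonempty hne
      fun j hj => hc j (Finset.mem_compl.mp hj)
  rw [hcard] at hout
  rw [← Finset.sum_add_sum_compl A x]
  linarith


/-- Lemma 2: if `2 ≤ b ≤ d-1 ≤ Δ-1` and `x_1,…,x_d ∈ [0,1]` sum to at least `b`,
then there is a set `S` of `b-1` indices with `x_j ≥ 2/(δ+1)` for `j ∈ S`, and an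
additional index `j₀ ∉ S` with `x_{j₀} ≥ 1/δ`, where `δ = Δ - b + 1`. -/
theorem b_minus_one_values_ge_two_over_delta_plus_one
    (b d Δ : ℕ) (hb : 2 ≤ b) (hbd : b + 1 ≤ d) (hdΔ : d ≤ Δ)
    (x : Fin d → ℝ) (hx : ∀ j, x j ∈ Set.Icc (0 : ℝ) 1)
    (hsum : (b : ℝ) ≤ ∑ j, x j) :
    ∃ S : Finset (Fin d), S.card = b - 1 ∧
      (∀ j ∈ S, 2 / (((Δ : ℝ) - b + 1) + 1) ≤ x j) ∧
      ∃ j₀, j₀ ∉ S ∧ 1 / ((Δ : ℝ) - b + 1) ≤ x j₀ := by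
  have hbΔ : (b : ℝ) + 1 ≤ Δ := by exact_mod_cast hbd.trans hdΔ
  have hdΔ' : (d : ℝ) ≤ Δ := by exact_mod_cast hdΔ
  obtain ⟨δ, hδ⟩ : ∃ δ : ℝ, δ = (Δ : ℝ) - b + 1 := ⟨_, rfl⟩
  rw [← hδ]
  have hδ2 : 2 ≤ δ := by linarith
  have hx1 : ∀ j, x j ≤ 1 := fun j => (hx j).2
  obtain ⟨T, hT⟩ : ∃ T : Finset (Fin d), T = Finset.univ.filter (fun j => 2 / (δ + 1) ≤ x j) :=
    ⟨_, rfl⟩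
  have hTcard : b - 1 ≤ T.card := by
    by_contra! hlt
    have hsmall : (T.card : ℝ) + 2 ≤ b := by
      exact_mod_cast (by omega : T.card + 2 ≤ b)
    have h := sum_lt_card_add_mul_of_lt_off x hx1 T (by rw [Fintype.card_fin]; omega)
      (2 / (δ + 1)) fun j hj => by simpa [hT] using hj
    rw [Fintype.card_fin] at h
    have hc0 : 0 ≤ 2 / (δ + 1) := by positivity
    have hc1 : 2 / (δ + 1) ≤ 1 := by rw [div_le_one (by linarith)]; linarith
    have hc : (δ + 1) * (2 / (δ + 1)) = 2 := by field_simp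
    generalize 2 / (δ + 1) = c at *
    have h1 : ((d : ℝ) - T.card) * c ≤ (δ + 1 + (b - 2 - T.card)) * c :=
      mul_le_mul_of_nonneg_right (by linarith) hc0
    have h2 : ((b : ℝ) - 2 - T.card) * c ≤ b - 2 - T.card :=
      mul_le_of_le_one_right (by linarith) hc1
    linarith
  obtain ⟨S, hST, hS⟩ := Finset.exists_subset_card_eq hTcard
  refine ⟨S, hS, fun j hj => by simpa [hT] using hST hj, ?_⟩
  by_contra! hlt
  have hScard : (S.card : ℝ) = b - 1 := by
    rw [hS, Nat.cast_sub (by omega), Nat.cast_one]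
  have h := sum_lt_card_add_mul_of_lt_off x hx1 S (by rw [Fintype.card_fin]; omega) (1 / δ) hlt
  rw [Fintype.card_fin, hScard] at h
  have hle : ((d : ℝ) - (b - 1)) * (1 / δ) ≤ δ * (1 / δ) :=
    mul_le_mul_of_nonneg_right (by linarith) (by positivity)
  have hc : δ * (1 / δ) = 1 := by field_simp
  linarith
end

section
/- Let H = (V, E) be a finite hypergraph with n = |V| vertices, maximum vertex degree Δ, and let b_v ∈ ℕ with 2 ≤ b_v ≤ d(v) − 1 for every vertex v, where d(v) is the number of edges containing v. Set b := min_v b_v and δ := Δ − b + 1. Let x* ∈ [0,1]^E be a feasible fractional set multicover, i.e. ∑_{E ∋ v} x*_E ≥ b_v for every v ∈ V, and suppose n ≥ 1. Then C := {E ∈ E : x*_E ≥ 1/δ} is a set multicover of H (every vertex v lies in at least b_v edges of C) and |C| < δ · ∑_{E ∈ E} x*_E. -/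
open Finset

/-- If weights bounded by `1` on `s` sum to at least `k ≤ #s`, and `#s - k + 1 ≤ δ` with `1 ≤ δ`,
then at least `k` of them are at least `1 / δ`. -/
theorem le_card_filter_of_le_sum {ι : Type*} (s : Finset ι) (x : ι → ℝ) (k : ℕ) (δ : ℝ)
    (hδ : 1 ≤ δ) (hks : k ≤ s.card) (hs : (s.card : ℝ) - k + 1 ≤ δ)
    (hx : ∀ i ∈ s, x i ≤ 1) (hsum : (k : ℝ) ≤ ∑ i ∈ s, x i) :
    k ≤ (s.filter (fun i => 1 / δ ≤ x i)).card := by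
  by_contra! hlt
  have hδ0 : 0 < δ := by linarith
  have hcard := s.card_filter_add_card_filter_not (fun i => 1 / δ ≤ x i)
  rw [← s.sum_filter_add_sum_filter_not (fun i => 1 / δ ≤ x i)] at hsum
  set A := s.filter (fun i => 1 / δ ≤ x i)
  set B := s.filter (fun i => ¬ 1 / δ ≤ x i)
  have hA : ∑ i ∈ A, x i ≤ A.card := by
    simpa using sum_le_card_nsmul A x 1 fun i hi => hx i (mem_filter.1 hi).1
  have hne : B.Nonempty := card_pos.1 (by omega)
  have hBlt : δ * ∑ i ∈ B, x i < B.card := by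
    have h := sum_lt_sum_of_nonempty hne (f := x) (g := fun _ => 1 / δ)
      fun i hi => not_le.1 (mem_filter.1 hi).2
    rw [sum_const, nsmul_eq_mul, mul_one_div, lt_div_iff₀ hδ0] at h
    linarith
  have hAk : (A.card : ℝ) + 1 ≤ k := by exact_mod_cast hlt
  have hcard' : (A.card : ℝ) + B.card = s.card := by exact_mod_cast hcard
  nlinarith [mul_le_mul_of_nonneg_left hsum hδ0.le, mul_le_mul_of_nonneg_left hA hδ0.le,
    mul_le_mul_of_nonneg_left hAk (sub_nonneg.2 hδ)]

/-- If nonnegative weights include one exceeding `1 / δ`, then strictly fewer than `δ` times the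
total weight of them are at least `1 / δ`. -/
theorem card_filter_lt_mul_sum {ι : Type*} [Fintype ι] (x : ι → ℝ) (δ : ℝ) (hδ : 0 < δ)
    (hx : ∀ i, 0 ≤ x i) (hex : ∃ i, 1 / δ < x i) :
    ((univ.filter (fun i => 1 / δ ≤ x i)).card : ℝ) < δ * ∑ i, x i := by
  obtain ⟨i, hi⟩ := hex
  calc ((univ.filter (fun i => 1 / δ ≤ x i)).card : ℝ)
      = ∑ i ∈ univ.filter (fun i => 1 / δ ≤ x i), (1 : ℝ) := by simp
    _ < ∑ i ∈ univ.filter (fun i => 1 / δ ≤ x i), δ * x i :=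
        sum_lt_sum (fun j hj => (div_le_iff₀' hδ).1 (mem_filter.1 hj).2)
          ⟨i, by simpa using hi.le, (div_lt_iff₀' hδ).1 hi⟩
    _ ≤ ∑ i, δ * x i :=
        sum_le_sum_of_subset_of_nonneg (filter_subset _ _)
          fun j _ _ => mul_nonneg hδ.le (hx j)
    _ = δ * ∑ i, x i := (mul_sum _ _ _).symm

/-- Corollary 1: for a hypergraph with max degree `Δ` and a feasible fractional
multicover `x*`, the set `C = {E : x*_E ≥ 1/δ}` (with `δ = Δ - b + 1`,
`b = min_v b_v`) is a set multicover and `|C| < δ·∑_E x*_E`. -/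
theorem threshold_set_is_multicover
    {V ι : Type*} [Fintype V] [Fintype ι] [DecidableEq V] [Nonempty V]
    (E : ι → Finset V) (Δ : ℕ)
    (hΔ : ∀ v : V, (univ.filter (fun i => v ∈ E i)).card ≤ Δ)
    (b : V → ℕ) (hb2 : ∀ v, 2 ≤ b v)
    (hbd : ∀ v, b v + 1 ≤ (univ.filter (fun i => v ∈ E i)).card)
    (bm : ℕ) (hbm : bm = univ.inf' univ_nonempty b)
    (δ : ℝ) (hδ : δ = (Δ : ℝ) - bm + 1)
    (x : ι → ℝ) (hx : ∀ i, x i ∈ Set.Icc (0 : ℝ) 1)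
    (hfeas : ∀ v : V, (b v : ℝ) ≤ ∑ i ∈ univ.filter (fun i => v ∈ E i), x i) :
    (∀ v : V, b v ≤ ((univ.filter (fun i => 1 / δ ≤ x i)).filter
        (fun i => v ∈ E i)).card) ∧
    ((univ.filter (fun i => 1 / δ ≤ x i)).card : ℝ) < δ * ∑ i, x i := by
  obtain ⟨w, -, hw⟩ := exists_mem_eq_inf' univ_nonempty b
  rw [← hbm] at hw
  have hb2w : (2 : ℝ) ≤ b w := by exact_mod_cast hb2 w
  have hΔw : (b w : ℝ) + 1 ≤ Δ := by exact_mod_cast (hbd w).trans (hΔ w)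
  rw [hw] at hδ
  have hδ0 : 0 < δ := by linarith
  refine ⟨fun v => ?_, card_filter_lt_mul_sum x δ hδ0 (fun i => (hx i).1) ?_⟩
  · rw [filter_comm]
    have hwv : (b w : ℝ) ≤ b v := by
      exact_mod_cast hw ▸ hbm ▸ inf'_le b (mem_univ v)
    have hΔv : ((univ.filter (fun i => v ∈ E i)).card : ℝ) ≤ Δ := by exact_mod_cast hΔ v
    exact le_card_filter_of_le_sum _ x (b v) δ (by linarith) (by have := hbd v; omega)
      (by linarith) (fun i _ => (hx i).2) (hfeas v)
  · by_contra! hle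
    have hsum := (hfeas w).trans (sum_le_card_nsmul _ x (1 / δ) fun i _ => hle i)
    rw [nsmul_eq_mul, mul_one_div, le_div_iff₀ hδ0] at hsum
    have hdw : ((univ.filter (fun i => w ∈ E i)).card : ℝ) ≤ Δ := by exact_mod_cast hΔ w
    nlinarith
end

section
/- Let b ≥ 2 and δ ≥ 3 be natural numbers, ℓ ≥ 1 a natural number, and set α := (b−1) · δ · e^{δ/4} / (47ℓ). Let x*_1, …, x*_m ∈ [0,1] with Opt* := ∑_{j=1}^m x*_j, and define C₁ := {j : x*_j ≥ 2/(δ+1)} and C₂ := {j : 1/δ ≤ x*_j < 2/(δ+1)}. If |C₁| ≥ α · Opt*, then |C₁| + |C₂| ≤ (1 − (b−1)e^{δ/4}/(94ℓ)) · δ · Opt*. -/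
open Finset

/-- A sum of nonnegative reals is bounded below by counting the terms above `t` with weight `t` and
those in `[s, t)` with weight `s`. -/
theorem weighted_card_le_sum {ι : Type*} [Fintype ι] (x : ι → ℝ) (hx : ∀ j, 0 ≤ x j) (s t : ℝ) :
    ((univ.filter (fun j => t ≤ x j)).card : ℝ) * t
      + ((univ.filter (fun j => s ≤ x j ∧ x j < t)).card : ℝ) * s ≤ ∑ j, x j := by
  simp only [← nsmul_eq_mul, ← sum_const, sum_filter]
  rw [← sum_add_distrib]
  refine sum_le_sum fun j _ => ?_
  have := hx j
  split_ifs <;> linarith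

/-- Theorem 4, first case: if `|C₁| ≥ α·Opt*` with `α = (b-1)δe^{δ/4}/(47ℓ)`, then
`|C₁| + |C₂| ≤ (1 - (b-1)e^{δ/4}/(94ℓ))·δ·Opt*`. -/
theorem case_C1_large
    (b δ ℓ : ℕ) (hb : 2 ≤ b) (hδ : 3 ≤ δ) (hℓ : 1 ≤ ℓ)
    (m : ℕ) (x : Fin m → ℝ) (hx : ∀ j, x j ∈ Set.Icc (0 : ℝ) 1)
    (hC₁large :
      ((b : ℝ) - 1) * δ * Real.exp ((δ : ℝ) / 4) / (47 * ℓ) * ∑ j, x j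
        ≤ ((univ.filter (fun j => 2 / ((δ : ℝ) + 1) ≤ x j)).card : ℝ)) :
    ((univ.filter (fun j => 2 / ((δ : ℝ) + 1) ≤ x j)).card : ℝ)
      + ((univ.filter (fun j => 1 / (δ : ℝ) ≤ x j ∧ x j < 2 / ((δ : ℝ) + 1))).card : ℝ)
      ≤ (1 - ((b : ℝ) - 1) * Real.exp ((δ : ℝ) / 4) / (94 * ℓ)) * δ * ∑ j, x j := by
  have hδR : (3 : ℝ) ≤ δ := by exact_mod_cast hδ
  have hℓR : (1 : ℝ) ≤ ℓ := by exact_mod_cast hℓ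
  have hsum := weighted_card_le_sum x (fun j => (hx j).1) (1 / (δ : ℝ)) (2 / ((δ : ℝ) + 1))
  set S := ∑ j, x j
  set A := ((univ.filter (fun j => 2 / ((δ : ℝ) + 1) ≤ x j)).card : ℝ)
  set B := ((univ.filter (fun j => 1 / (δ : ℝ) ≤ x j ∧ x j < 2 / ((δ : ℝ) + 1))).card : ℝ)
  have hA0 : 0 ≤ A := Nat.cast_nonneg _
  have hscaled : δ * (A * (2 / ((δ : ℝ) + 1)) + B * (1 / (δ : ℝ))) ≤ δ * S :=
    mul_le_mul_of_nonneg_left hsum (by positivity)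
  have hB : (δ : ℝ) * (B * (1 / (δ : ℝ))) = B := by field_simp
  have hcoef : (3 : ℝ) / 2 ≤ δ * (2 / ((δ : ℝ) + 1)) := by
    rw [← mul_div_assoc, le_div_iff₀ (by positivity)]
    linarith
  have hA' : 3 / 2 * A ≤ δ * (2 / ((δ : ℝ) + 1)) * A := mul_le_mul_of_nonneg_right hcoef hA0
  have hsplit : (1 - ((b : ℝ) - 1) * Real.exp ((δ : ℝ) / 4) / (94 * ℓ)) * δ * S
      = δ * S - ((b : ℝ) - 1) * δ * Real.exp ((δ : ℝ) / 4) / (47 * ℓ) * S / 2 := by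
    field_simp
    ring
  rw [hsplit]
  linarith
end

section
/- Let H = (V, E) be a finite hypergraph with n vertices and m edges, b_v ∈ ℕ for v ∈ V with b_v ≤ d(v), and set k_v := d(v) − b_v for every vertex v. Let Δ̄ := (1/n)∑_{v∈V} d(v) be the average vertex degree, ℓ̄ := (1/m)∑_{E∈E} |E| the average edge size, ℓ the maximum edge size, b̄ := (1/n)∑_{v∈V} b_v, and let Opt denote the minimum cardinality of a set multicover of H. Then the maximum cardinality ν_k(H) of a k-matching in H satisfies ν_k(H) ≤ ( (Δ̄ · ℓ)/(b̄ · ℓ̄) − 1 ) · Opt. -/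
open Finset

/-- `M` is a `k`-matching: every vertex `v` lies in at most `k v` edges of `M`. -/
def IsKMatching {V ι : Type*} [DecidableEq V] (E : ι → Finset V) (k : V → ℕ)
    (M : Finset ι) : Prop :=
  ∀ v : V, (M.filter (fun i => v ∈ E i)).card ≤ k v

/-- `C` is a `b`-set multicover: every vertex `v` lies in at least `b v` edges of `C`. -/
def IsMulticover {V ι : Type*} [DecidableEq V] (E : ι → Finset V) (b : V → ℕ)
    (C : Finset ι) : Prop :=
  ∀ v : V, b v ≤ (C.filter (fun i => v ∈ E i)).card

/-- Double counting of the incidences between the vertices and the edges in `C`. -/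
theorem sum_card_filter_mem {V ι : Type*} [Fintype V] [DecidableEq V]
    (E : ι → Finset V) (C : Finset ι) :
    ∑ v : V, (C.filter (fun i => v ∈ E i)).card = ∑ i ∈ C, (E i).card := by
  simp_rw [card_filter]
  rw [sum_comm]
  simp

/-- The complement of a `(d - b)`-matching is a `b`-set multicover. -/
theorem IsKMatching.isMulticover_compl {V ι : Type*} [Fintype ι] [DecidableEq V] [DecidableEq ι]
    {E : ι → Finset V} {b : V → ℕ} {M : Finset ι}
    (hbd : ∀ v : V, b v ≤ (univ.filter (fun i => v ∈ E i)).card)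
    (hM : IsKMatching E (fun v => (univ.filter (fun i => v ∈ E i)).card - b v) M) :
    IsMulticover E b Mᶜ := by
  intro v
  have hsum : (M.filter (fun i => v ∈ E i)).card + (Mᶜ.filter (fun i => v ∈ E i)).card =
      (univ.filter (fun i => v ∈ E i)).card := by
    simp_rw [card_filter]
    exact sum_add_sum_compl M _
  have hv := hM v
  have hbv := hbd v
  dsimp only at hv
  omega

/-- The total demand of a set multicover `C` is at most `|C|` times the maximum edge size. -/
theorem IsMulticover.sum_le_card_mul {V ι : Type*} [Fintype V] [DecidableEq V]
    {E : ι → Finset V} {b : V → ℕ} {C : Finset ι} (hC : IsMulticover E b C)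
    {ℓ : ℕ} (hℓ : ∀ i, (E i).card ≤ ℓ) :
    ∑ v : V, b v ≤ C.card * ℓ :=
  calc ∑ v : V, b v ≤ ∑ v : V, (C.filter (fun i => v ∈ E i)).card :=
        sum_le_sum fun v _ => hC v
    _ = ∑ i ∈ C, (E i).card := sum_card_filter_mem E C
    _ ≤ C.card * ℓ := sum_le_card_nsmul C _ ℓ fun i _ => hℓ i

/-- Lemma 6: `ν_k(H) ≤ (Δ̄ℓ/(b̄ℓ̄) - 1)·Opt`, i.e. every `k`-matching `M`
(with `k_v = d(v) - b_v`) satisfies `|M| ≤ (Δ̄ℓ/(b̄ℓ̄) - 1)·|C|` for every minimum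
set multicover `C`. -/
theorem matching_number_le
    {V ι : Type*} [Fintype V] [Fintype ι] [DecidableEq V] [Nonempty V] [Nonempty ι]
    (E : ι → Finset V) (b : V → ℕ) (hb1 : ∀ v, 1 ≤ b v)
    (hbd : ∀ v : V, b v ≤ (univ.filter (fun i => v ∈ E i)).card)
    (ℓ : ℕ) (hℓ : ∀ i, (E i).card ≤ ℓ)
    (M : Finset ι)
    (hM : IsKMatching E (fun v => (univ.filter (fun i => v ∈ E i)).card - b v) M)
    (C : Finset ι) (hC : IsMulticover E b C)
    (hCmin : ∀ D : Finset ι, IsMulticover E b D → C.card ≤ D.card) :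
    (M.card : ℝ) ≤
      (((∑ v : V, ((univ.filter (fun i => v ∈ E i)).card : ℝ)) / Fintype.card V) * ℓ /
        (((∑ v : V, (b v : ℝ)) / Fintype.card V) *
          ((∑ i : ι, ((E i).card : ℝ)) / Fintype.card ι)) - 1) * C.card := by
  classical
  have hcard : M.card + C.card ≤ Fintype.card ι := by
    have hle := hCmin _ (hM.isMulticover_compl hbd)
    have hadd := card_add_card_compl M
    omega
  have hcover : (∑ v : V, (b v : ℝ)) ≤ C.card * ℓ := by
    exact_mod_cast hC.sum_le_card_mul hℓ
  have hdeg : (∑ v : V, ((univ.filter (fun i => v ∈ E i)).card : ℝ)) =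
      ∑ i : ι, ((E i).card : ℝ) := by
    exact_mod_cast sum_card_filter_mem E univ
  have hBpos : 0 < ∑ v : V, (b v : ℝ) :=
    sum_pos (fun v _ => by exact_mod_cast hb1 v) univ_nonempty
  have hSpos : 0 < ∑ i : ι, ((E i).card : ℝ) := by
    rw [← hdeg]
    exact hBpos.trans_le (sum_le_sum fun v _ => by exact_mod_cast hbd v)
  have hcardR : (M.card : ℝ) + C.card ≤ Fintype.card ι := by exact_mod_cast hcard
  have hn : (0 : ℝ) < Fintype.card V := by exact_mod_cast Fintype.card_pos
  have hm : (0 : ℝ) < Fintype.card ι := by exact_mod_cast Fintype.card_pos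
  rw [hdeg]
  generalize (∑ i : ι, ((E i).card : ℝ)) = S at *
  generalize (∑ v : V, (b v : ℝ)) = B at *
  have hratio : S / Fintype.card V * ℓ / (B / Fintype.card V * (S / Fintype.card ι)) =
      Fintype.card ι * ℓ / B := by
    field_simp
  have hbound : (Fintype.card ι : ℝ) ≤ Fintype.card ι * ℓ / B * C.card := by
    rw [div_mul_eq_mul_div, le_div_iff₀ hBpos]
    nlinarith
  rw [hratio]
  linarith
end
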